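/- arXiv:2101.10479 — 2 statements merged into one kernel-verified Lean document; each statement's English description precedes it below -/
import Mathlib

section
/- Let X be a measurable space, n ∈ ℕ, ν : Fin n → Measure X a family of probability measures on X, and U a measurable subset of X. Then for every k ∈ ℕ, the product measure ⊗_{i} ν_i of the set of n-tuples x : Fin n → X having exactly k components in U equals the sum over subsets s ⊆ Fin n of cardinality k of ∏_{i ∈ s} ν_i(U) · ∏_{i ∉ s} ν_i(Uᶜ). Equivalently, the pushforward of ⊗_i ν_i along K_n assigns to A^U_k the coefficient of z^k in the polynomial ∏_{i} (ν_i(Uᶜ) + ν_i(U)·z). -/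
open MeasureTheory
open scoped ENNReal

/-- `bagA U k` is the set `A^U_k` of bags with exactly `k` elements
(counted with multiplicity) lying in `U`. -/
def bagA {X : Type*} (U : Set X) (k : ℕ) : Set (Multiset X) :=
  {b | @Multiset.countP X (· ∈ U) (Classical.decPred _) b = k}

/-- The bag σ-algebra on `Multiset X`, generated by the sets `A^U_k`
for `U` measurable and `k : ℕ`. -/
instance bagMeasurableSpace (X : Type*) [MeasurableSpace X] : MeasurableSpace (Multiset X) :=
  MeasurableSpace.generateFrom {A | ∃ (U : Set X) (k : ℕ), MeasurableSet U ∧ A = bagA U k}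

/-- `bagK n` sends an `n`-tuple to the bag of its components. -/
def bagK {X : Type*} (n : ℕ) (x : Fin n → X) : Multiset X :=
  (List.ofFn x : List X)

/-- The tuples with exactly `k` components in `U` are partitioned by the set of indices of the
components lying in `U`. -/
theorem setOf_card_eq_biUnion_pi {X ι : Type*} [Fintype ι] [DecidableEq ι] (U : Set X) (k : ℕ) :
    {x : ι → X | Nat.card {i : ι // x i ∈ U} = k} =
      ⋃ s ∈ Finset.powersetCard k (Finset.univ : Finset ι),
        Set.univ.pi fun i => if i ∈ s then U else Uᶜ := by
  classical
  ext x
  simp only [Set.mem_ofPred_eq, Set.mem_iUnion, Set.mem_univ_pi, Finset.mem_powersetCard_univ,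
    exists_prop, Nat.card_eq_fintype_card, Fintype.card_subtype]
  constructor
  · intro h
    refine ⟨_, h, fun i => ?_⟩
    by_cases hi : x i ∈ U <;> simp [hi]
  · rintro ⟨s, rfl, hs⟩
    congr 1
    ext i
    have := hs i
    by_cases hi : i ∈ s <;> simp_all

theorem pairwiseDisjoint_pi_ite {X ι : Type*} [DecidableEq ι] (U : Set X) (S : Set (Finset ι)) :
    S.PairwiseDisjoint fun s => Set.univ.pi fun i => if i ∈ s then U else Uᶜ := by
  intro s _ t _ hst
  refine Set.disjoint_left.2 fun x hs ht => hst ?_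
  ext i
  have h₁ := hs i trivial
  have h₂ := ht i trivial
  by_cases his : i ∈ s <;> by_cases hit : i ∈ t <;> simp_all

theorem pi_pi_ite {X ι : Type*} [MeasurableSpace X] [Fintype ι] [DecidableEq ι]
    (ν : ι → Measure X) [∀ i, SigmaFinite (ν i)] (U : Set X) (s : Finset ι) :
    Measure.pi ν (Set.univ.pi fun i => if i ∈ s then U else Uᶜ) =
      (∏ i ∈ s, ν i U) * ∏ i ∈ sᶜ, ν i Uᶜ := by
  rw [Measure.pi_pi, ← Finset.prod_mul_prod_compl s]
  congr 1
  · exact Finset.prod_congr rfl fun i hi => by rw [if_pos hi]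
  · exact Finset.prod_congr rfl fun i hi => by rw [if_neg (Finset.mem_compl.1 hi)]

theorem measurableSet_pi_ite {X ι : Type*} [MeasurableSpace X] [Countable ι] [DecidableEq ι]
    {U : Set X} (hU : MeasurableSet U) (s : Finset ι) :
    MeasurableSet (Set.univ.pi fun i => if i ∈ s then U else Uᶜ) :=
  .univ_pi fun i => by split_ifs <;> [exact hU; exact hU.compl]

theorem bagK_preimage_bagA {X : Type*} (n : ℕ) (U : Set X) (k : ℕ) :
    bagK n ⁻¹' bagA U k = {x : Fin n → X | Nat.card {i : Fin n // x i ∈ U} = k} := by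
  classical
  ext x
  have hx : bagK n x = (Finset.univ : Finset (Fin n)).val.map x := by
    rw [bagK, List.ofFn_eq_map]
    rfl
  rw [Set.mem_preimage, hx, bagA, Set.mem_ofPred_eq, Set.mem_ofPred_eq, Multiset.countP_map,
    Nat.card_eq_fintype_card, Fintype.card_subtype]
  simp only [Finset.card_def, Finset.filter_val]

theorem measurable_bagK {X : Type*} [MeasurableSpace X] (n : ℕ) :
    Measurable (bagK n : (Fin n → X) → Multiset X) := by
  refine measurable_generateFrom ?_
  rintro _ ⟨U, k, hU, rfl⟩
  rw [bagK_preimage_bagA, setOf_card_eq_biUnion_pi]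
  exact Finset.measurableSet_biUnion _ fun s _ => measurableSet_pi_ite hU s

theorem measurableSet_bagA {X : Type*} [MeasurableSpace X] {U : Set X} (hU : MeasurableSet U)
    (k : ℕ) : MeasurableSet (bagA U k) :=
  MeasurableSpace.measurableSet_generateFrom ⟨U, k, hU, rfl⟩

/-- The value of the distributive law `l[ν₁,…,νₙ] = (Kₙ)_*(⊗ᵢ νᵢ)` on the
generating set `A^U_k`: the product measure of the set of tuples with exactly
`k` components in `U` is `∑_{s ⊆ Fin n, |s| = k} ∏_{i ∈ s} νᵢ(U) ∏_{i ∉ s} νᵢ(Uᶜ)`,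
the coefficient of `z^k` in `∏ᵢ (νᵢ(Uᶜ) + νᵢ(U)·z)`. -/
theorem pi_tuples_k_in {X : Type*} [MeasurableSpace X] (n : ℕ) (ν : Fin n → Measure X)
    [∀ i, IsProbabilityMeasure (ν i)] {U : Set X} (hU : MeasurableSet U) (k : ℕ) :
    Measure.pi ν {x : Fin n → X | Nat.card {i : Fin n // x i ∈ U} = k}
        = ∑ s ∈ Finset.powersetCard k (Finset.univ : Finset (Fin n)),
            (∏ i ∈ s, ν i U) * ∏ i ∈ sᶜ, ν i Uᶜ ∧
      Measure.map (bagK n) (Measure.pi ν) (bagA U k)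
        = ∑ s ∈ Finset.powersetCard k (Finset.univ : Finset (Fin n)),
            (∏ i ∈ s, ν i U) * ∏ i ∈ sᶜ, ν i Uᶜ := by
  rw [Measure.map_apply (measurable_bagK n) (measurableSet_bagA hU k), bagK_preimage_bagA,
    and_self, setOf_card_eq_biUnion_pi,
    measure_biUnion_finset (pairwiseDisjoint_pi_ite U _) fun s _ => measurableSet_pi_ite hU s]
  exact Finset.sum_congr rfl fun s _ => pi_pi_ite ν U s
end

section
/- Let X be a measurable space. The map i^B : Multiset X → Measure X sending a bag [x_1,…,x_n] to the multiplicity-respecting sum of Dirac measures ∑_{i=1}^n δ_{x_i} is measurable, where Multiset X carries the bag σ-algebra and Measure X the σ-algebra generated by the evaluation maps μ ↦ μ(U) for measurable U. (Indeed, the preimage of the generating set {μ | μ(U) < r} is the union ⋃_{i=0}^{⌊r⌋} A^U_i.) -/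
open MeasureTheory
open scoped ENNReal

/-- `iB` sends a bag to its counting measure, the multiplicity-respecting
sum of Dirac measures at its elements. -/
noncomputable def iB {X : Type*} [MeasurableSpace X] (b : Multiset X) : Measure X :=
  (b.map Measure.dirac).sum

/-- The counting measure of a bag assigns to a measurable set the number of elements
of the bag lying in it. -/
theorem iB_apply {X : Type*} [MeasurableSpace X] {U : Set X} (hU : MeasurableSet U)
    (b : Multiset X) :
    iB b U = (@Multiset.countP X (· ∈ U) (Classical.decPred _) b : ℝ≥0∞) := by
  classical
  induction b using Multiset.induction_on with
  | empty => simp [iB]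
  | cons a s ih =>
    have h : iB (a ::ₘ s) = Measure.dirac a + iB s := by simp [iB]
    rw [h, Measure.add_apply, ih, Measure.dirac_apply' a hU, Multiset.countP_cons]
    by_cases ha : a ∈ U <;> simp [ha, add_comm]

/-- Counting the elements of a bag that lie in a measurable set is measurable. -/
theorem measurable_countP_mem {X : Type*} [MeasurableSpace X] {U : Set X}
    (hU : MeasurableSet U) :
    Measurable fun b : Multiset X ↦ @Multiset.countP X (· ∈ U) (Classical.decPred _) b :=
  measurable_to_countable' fun k ↦ MeasurableSpace.measurableSet_generateFrom ⟨U, k, hU, rfl⟩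

/-- The map `i^B` sending a bag to its counting measure is measurable, from the
bag σ-algebra to the σ-algebra on measures generated by the evaluation maps. -/
theorem iB_measurable {X : Type*} [MeasurableSpace X] :
    Measurable (iB : Multiset X → Measure X) := by
  refine Measure.measurable_of_measurable_coe _ fun U hU ↦ ?_
  simp only [iB_apply hU]
  exact measurable_from_top.comp (measurable_countP_mem hU)
end
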